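/- arXiv:2105.06686 — 2 statements merged into one kernel-verified Lean document; each statement's English description precedes it below -/
import Mathlib

section
/- For every time-divergent infinite play π of a timed game G with priority function p and bound λ ∈ ℕ∖{0}: π satisfies the timed window objective TW(p,λ) if and only if its expansion Ex(π) satisfies the co-Büchi objective coBüchi(Bad) in the expanded timed game G(p,λ), where Bad = L × {bad}. -/
open scoped NNReal

namespace TWPaper

variable {L C Act : Type}

/-- Comparison operators appearing in clock constraints. -/
inductive Cmp where
  | le | ge | lt | gt

/-- An atomic clock constraint `x ∼ c` with `c : ℕ`. -/
structure Atom (C : Type) where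
  clock : C
  cmp : Cmp
  bound : ℕ

/-- Clock valuations. -/
abbrev Val (C : Type) := C → ℝ≥0

def Atom.sat (ν : Val C) (a : Atom C) : Prop :=
  match a.cmp with
  | Cmp.le => ν a.clock ≤ (a.bound : ℝ≥0)
  | Cmp.ge => (a.bound : ℝ≥0) ≤ ν a.clock
  | Cmp.lt => ν a.clock < (a.bound : ℝ≥0)
  | Cmp.gt => (a.bound : ℝ≥0) < ν a.clock

/-- A clock constraint: a finite conjunction of atomic constraints. -/
abbrev ClockConstraint (C : Type) := List (Atom C)

def satCC (ν : Val C) (g : ClockConstraint C) : Prop := ∀ a ∈ g, a.sat ν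

/-- Let `d` time units pass. -/
def shift (ν : Val C) (d : ℝ≥0) : Val C := fun x => ν x + d

open Classical in
/-- Reset the clocks in `D` to `0`. -/
noncomputable def resetV (D : Set C) (ν : Val C) : Val C :=
  fun x => if x ∈ D then 0 else ν x

structure Edge (L C Act : Type) where
  src : L
  guard : ClockConstraint C
  act : Act
  resets : Set C
  tgt : L

/-- A timed automaton. -/
structure TA (L C Act : Type) where
  init : L
  gamma : C
  inv : L → ClockConstraint C
  edges : Set (Edge L C Act)

/-- Well-formedness of a timed automaton: the special global clock `γ` is never
reset, and no two edges from the same location sharing an action have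
simultaneously satisfiable guards (determinism). -/
def TA.WellFormed (A : TA L C Act) : Prop :=
  (∀ e ∈ A.edges, A.gamma ∉ e.resets) ∧
  (∀ e₁ ∈ A.edges, ∀ e₂ ∈ A.edges, e₁.src = e₂.src → e₁.act = e₂.act →
    (∃ ν : Val C, satCC ν e₁.guard ∧ satCC ν e₂.guard) → e₁ = e₂)

/-- A move: a delay together with an action (`none` is the special delay action `⊥`). -/
abbrev Mv (Act : Type) := ℝ≥0 × Option Act

/-- The transition relation of the transition system of a timed automaton. -/
def TA.Trans (A : TA L C Act) (s : L × Val C) (m : Mv Act) (s' : L × Val C) : Prop :=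
  satCC (shift s.2 m.1) (A.inv s.1) ∧
  (match m.2 with
   | none => s'.1 = s.1 ∧ s'.2 = shift s.2 m.1
   | some a => ∃ e ∈ A.edges, e.src = s.1 ∧ e.act = a ∧
       satCC (shift s.2 m.1) e.guard ∧ s'.1 = e.tgt ∧
       s'.2 = resetV e.resets (shift s.2 m.1) ∧ satCC s'.2 (A.inv e.tgt))

/-- An infinite path of a timed automaton (the underlying data). -/
structure RawPath (L C Act : Type) where
  s : ℕ → L × Val C
  m : ℕ → Mv Act

def TA.IsPath (A : TA L C Act) (π : RawPath L C Act) : Prop :=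
  ∀ n, A.Trans (π.s n) (π.m n) (π.s (n + 1))

/-- A timed game: a timed automaton together with a partition of the actions;
`isP1 a` means that `a` is a player-1 action (its complement is player 2's set). -/
structure TG (L C Act : Type) where
  ta : TA L C Act
  isP1 : Act → Prop

/-- Moves available to player 1 in state `s`. -/
def TG.Move1 (G : TG L C Act) (s : L × Val C) (m : Mv Act) : Prop :=
  (∀ a, m.2 = some a → G.isP1 a) ∧ ∃ s', G.ta.Trans s m s'

/-- Moves available to player 2 in state `s`. -/
def TG.Move2 (G : TG L C Act) (s : L × Val C) (m : Mv Act) : Prop :=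
  (∀ a, m.2 = some a → ¬ G.isP1 a) ∧ ∃ s', G.ta.Trans s m s'

/-- An infinite play of a timed game (the underlying data). -/
structure RawPlay (L C Act : Type) where
  s : ℕ → L × Val C
  m1 : ℕ → Mv Act
  m2 : ℕ → Mv Act

/-- The delay at step `n`: the minimum of the delays of the two chosen moves. -/
def RawPlay.delay (π : RawPlay L C Act) (n : ℕ) : ℝ≥0 := min (π.m1 n).1 (π.m2 n).1

/-- The play obtained by removing the first `n` steps. -/
def RawPlay.drop (π : RawPlay L C Act) (n : ℕ) : RawPlay L C Act :=
  ⟨fun k => π.s (n + k), fun k => π.m1 (n + k), fun k => π.m2 (n + k)⟩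

/-- The joint destination relation: the fastest move is carried out,
nondeterministically so in case of a tie. -/
def TG.JointDest (G : TG L C Act) (s : L × Val C) (m₁ m₂ : Mv Act) (s' : L × Val C) : Prop :=
  (m₁.1 < m₂.1 ∧ G.ta.Trans s m₁ s') ∨ (m₂.1 < m₁.1 ∧ G.ta.Trans s m₂ s') ∨
  (m₁.1 = m₂.1 ∧ (G.ta.Trans s m₁ s' ∨ G.ta.Trans s m₂ s'))

def TG.StepOK (G : TG L C Act) (π : RawPlay L C Act) (n : ℕ) : Prop :=
  G.Move1 (π.s n) (π.m1 n) ∧ G.Move2 (π.s n) (π.m2 n) ∧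
  G.JointDest (π.s n) (π.m1 n) (π.m2 n) (π.s (n + 1))

def TG.IsPlay (G : TG L C Act) (π : RawPlay L C Act) : Prop := ∀ n, G.StepOK π n

/-- `π` is a valid play for its first `n` steps (i.e., viewed as a finite play
consisting of `n` moves). -/
def TG.IsPlayUpTo (G : TG L C Act) (π : RawPlay L C Act) (n : ℕ) : Prop :=
  ∀ k < n, G.StepOK π k

/-- The state/delay sequence of a play or path.  All the objectives considered
are state-based and are therefore defined on traces. -/
structure Trace (L C : Type) where
  st : ℕ → L × Val C
  dl : ℕ → ℝ≥0

def RawPlay.trace (π : RawPlay L C Act) : Trace L C := ⟨π.s, fun n => π.delay n⟩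
def RawPath.trace (π : RawPath L C Act) : Trace L C := ⟨π.s, fun n => (π.m n).1⟩

/-- The delayed suffix `π_{n→}^{+d}`. -/
noncomputable def Trace.delayedSuffix (τ : Trace L C) (n : ℕ) (d : ℝ≥0) : Trace L C where
  st := fun k => if k = 0 then ((τ.st n).1, shift (τ.st n).2 d) else τ.st (n + k)
  dl := fun k => if k = 0 then τ.dl n - d else τ.dl (n + k)

/-- The suffix `π_{n→} = π_{n→}^{+0}`. -/
noncomputable def Trace.suffix (τ : Trace L C) (n : ℕ) : Trace L C := τ.delayedSuffix n 0

/-- `min_{a ≤ k ≤ b} p(ℓ_k)`. -/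
noncomputable def minPrioIcc (p : L → ℕ) (τ : Trace L C) (a b : ℕ) : ℕ :=
  sInf ((fun k => p (τ.st k).1) '' Set.Icc a b)

/-- The timed good window objective `TGW(p, λ)`. -/
def TGW (γ : C) (p : L → ℕ) (lam : ℕ) : Set (Trace L C) :=
  {τ | ∃ j : ℕ, Even (minPrioIcc p τ 0 j) ∧ (τ.st j).2 γ - (τ.st 0).2 γ < (lam : ℝ≥0)}

/-- The direct timed window parity objective `DTW(p, λ)`. -/
def DTW (γ : C) (p : L → ℕ) (lam : ℕ) : Set (Trace L C) :=
  {τ | ∀ n : ℕ, ∀ d : ℝ≥0, d ≤ τ.dl n → τ.delayedSuffix n d ∈ TGW γ p lam}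

/-- The timed window parity objective `TW(p, λ)`. -/
def TW (γ : C) (p : L → ℕ) (lam : ℕ) : Set (Trace L C) :=
  {τ | ∃ n : ℕ, τ.suffix n ∈ DTW γ p lam}

/-- Time divergence: the global clock `γ` is unbounded along the trace. -/
def TimeDiv (γ : C) (τ : Trace L C) : Prop := ∀ B : ℝ≥0, ∃ j, B < (τ.st j).2 γ

/-- The parity objective: the least priority seen infinitely often is even. -/
def ParityObj (p : L → ℕ) : Set (Trace L C) :=
  {τ | Even (Filter.liminf (fun n => p (τ.st n).1) Filter.atTop)}

/-- The safety objective for the set `F` of locations. -/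
def SafeObj (F : Set L) : Set (Trace L C) := {τ | ∀ n, (τ.st n).1 ∉ F}

/-- The co-Büchi objective for the set `F` of locations. -/
def CoBuchiObj (F : Set L) : Set (Trace L C) := {τ | ∃ N, ∀ n ≥ N, (τ.st n).1 ∉ F}

/-! ### The expanded timed automaton (one dimension) -/

/-- Locations of the expanded automaton: `(ℓ, some q)` carries the priority `q`
of the current window, `(ℓ, none)` is the bad location `(ℓ, bad)`. -/
abbrev ExpLoc (L : Type) := L × Option ℕ
/-- Clocks of the expanded automaton: `none` is the fresh clock `z`. -/
abbrev ExpClock (C : Type) := Option C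
/-- Actions of the expanded automaton: `Sum.inr true = β₁` and `Sum.inr false = β₂`. -/
abbrev ExpAct (Act : Type) := Act ⊕ Bool

def liftAtom {C C' : Type} (f : C → C') (a : Atom C) : Atom C' := ⟨f a.clock, a.cmp, a.bound⟩

def liftCC {C C' : Type} (f : C → C') (g : ClockConstraint C) : ClockConstraint C' :=
  g.map (liftAtom f)

/-- The expanded timed automaton `A(p, λ)`, where the priorities used range over
`{0, …, d-1}`. -/
def expTA (A : TA L C Act) (d : ℕ) (p : L → ℕ) (lam : ℕ) :
    TA (ExpLoc L) (ExpClock C) (ExpAct Act) where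
  init := (A.init, some (p A.init))
  gamma := some A.gamma
  inv := fun lq =>
    match lq.2 with
    | some q => liftCC some (A.inv lq.1) ++
        (if q % 2 = 1 then [⟨none, Cmp.le, lam⟩] else [])
    | none => [⟨none, Cmp.le, 0⟩, ⟨none, Cmp.ge, 0⟩]
  edges :=
    {e : Edge (ExpLoc L) (ExpClock C) (ExpAct Act) |
      ∃ q < d, q % 2 = 0 ∧ ∃ e₀ ∈ A.edges,
        e = ⟨(e₀.src, some q), liftCC some e₀.guard, Sum.inl e₀.act,
             (Option.some '' e₀.resets) ∪ {none}, (e₀.tgt, some (p e₀.tgt))⟩} ∪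
    {e : Edge (ExpLoc L) (ExpClock C) (ExpAct Act) |
      ∃ q < d, q % 2 = 1 ∧ ∃ e₀ ∈ A.edges,
        e = ⟨(e₀.src, some q), liftCC some e₀.guard ++ [⟨none, Cmp.lt, lam⟩],
             Sum.inl e₀.act, Option.some '' e₀.resets,
             (e₀.tgt, some (min q (p e₀.tgt)))⟩} ∪
    {e : Edge (ExpLoc L) (ExpClock C) (ExpAct Act) |
      ∃ q < d, q % 2 = 1 ∧ ∃ (ℓ : L) (b : Bool),
        e = ⟨(ℓ, some q), [⟨none, Cmp.le, lam⟩, ⟨none, Cmp.ge, lam⟩], Sum.inr b,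
             {none}, (ℓ, none)⟩} ∪
    {e : Edge (ExpLoc L) (ExpClock C) (ExpAct Act) |
      ∃ (ℓ : L) (b : Bool), e = ⟨(ℓ, none), [], Sum.inr b, ∅, (ℓ, some (p ℓ))⟩}

/-- The expanded timed game `G(p, λ)`: `β₁` belongs to player 1, `β₂` to player 2. -/
def expTG (G : TG L C Act) (d : ℕ) (p : L → ℕ) (lam : ℕ) :
    TG (ExpLoc L) (ExpClock C) (ExpAct Act) :=
  ⟨expTA G.ta d p lam,
   fun a => match a with | Sum.inl a => G.isP1 a | Sum.inr b => b = true⟩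

/-- The set `Bad = L × {bad}` of bad locations. -/
def BadLocs (L : Type) : Set (ExpLoc L) := {lq | lq.2 = none}

/-! ### The projection mapping -/

def projMove (m : Mv (ExpAct Act)) : Mv Act :=
  (m.1, match m.2 with
        | some (Sum.inl a) => some a
        | some (Sum.inr _) => none
        | none => none)

def projState (s : ExpLoc L × Val (ExpClock C)) : L × Val C :=
  (s.1.1, fun c => s.2 (some c))

/-- The projection mapping `Pr`. -/
def projPlay (π : RawPlay (ExpLoc L) (ExpClock C) (ExpAct Act)) : RawPlay L C Act :=
  ⟨fun n => projState (π.s n), fun n => projMove (π.m1 n), fun n => projMove (π.m2 n)⟩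

/-- A play of the expanded game is well-initialized if `q₀ = p(ℓ₀)` and `ν₀(z) = 0`. -/
def WellInit (p : L → ℕ) (π : RawPlay (ExpLoc L) (ExpClock C) (ExpAct Act)) : Prop :=
  (π.s 0).1.2 = some (p (π.s 0).1.1) ∧ (π.s 0).2 none = 0

/-! ### The expansion mapping -/

def liftMove (m : Mv Act) : Mv (ExpAct Act) := (m.1, m.2.map Sum.inl)

def betaMv {Act : Type} (b : Bool) (t : ℝ≥0) : Mv (ExpAct Act) := (t, some (Sum.inr b))

/-- The conditions relating step `n` of a play `π` of `G` to the segment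
`[f n, f (n+1)]` of its expansion `π'`, following the inductive definition of
the expansion mapping `Ex`. -/
def ExStep (p : L → ℕ) (lam : ℕ) (π : RawPlay L C Act)
    (π' : RawPlay (ExpLoc L) (ExpClock C) (ExpAct Act)) (f : ℕ → ℕ) (n : ℕ) : Prop :=
  ∃ q : ℕ, (π'.s (f n)).1.2 = some q ∧
    (∀ z dn : ℝ≥0, z = (π'.s (f n)).2 none → dn = π.delay n →
      -- Cases 1 and 2.a : no bad window is detected during this step
      ((q % 2 = 0 ∨ z + dn < (lam : ℝ≥0)) →
        f (n + 1) = f n + 1 ∧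
        (q % 2 = 0 →
          π'.m1 (f n) = liftMove (π.m1 n) ∧ π'.m2 (f n) = liftMove (π.m2 n)) ∧
        (q % 2 = 1 →
          ((z + (π.m1 n).1 < (lam : ℝ≥0) → π'.m1 (f n) = liftMove (π.m1 n)) ∧
           ((lam : ℝ≥0) ≤ z + (π.m1 n).1 →
              π'.m1 (f n) = betaMv true ((lam : ℝ≥0) - z)) ∧
           (z + (π.m2 n).1 < (lam : ℝ≥0) → π'.m2 (f n) = liftMove (π.m2 n)) ∧
           ((lam : ℝ≥0) ≤ z + (π.m2 n).1 →
              π'.m2 (f n) = betaMv false ((lam : ℝ≥0) - z))))) ∧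
      -- Case 2.b : a bad window is detected during this step; the expansion
      -- visits the bad location `μ` times
      (q % 2 = 1 → (lam : ℝ≥0) ≤ z + dn →
        ∃ μ : ℕ, 1 ≤ μ ∧
          (p (π.s n).1 % 2 = 0 → μ = 1) ∧
          (p (π.s n).1 % 2 = 1 →
            ((μ * lam : ℕ) : ℝ≥0) ≤ z + dn ∧ z + dn < (((μ + 1) * lam : ℕ) : ℝ≥0)) ∧
          f (n + 1) = f n + 2 * μ + 1 ∧
          (∀ k < μ, (π'.s (f n + 2 * k + 1)).1 = ((π.s n).1, none)) ∧
          (∀ k, 1 ≤ k → k ≤ μ →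
            (π'.s (f n + 2 * k)).1 = ((π.s n).1, some (p (π.s n).1))) ∧
          π'.m1 (f n) = betaMv true ((lam : ℝ≥0) - z) ∧
          π'.m2 (f n) = betaMv false ((lam : ℝ≥0) - z) ∧
          (∀ k < μ, π'.m1 (f n + 2 * k + 1) = betaMv true 0 ∧
                    π'.m2 (f n + 2 * k + 1) = betaMv false 0) ∧
          (∀ k, 1 ≤ k → k < μ →
            π'.m1 (f n + 2 * k) = betaMv true (lam : ℝ≥0) ∧
            π'.m2 (f n + 2 * k) = betaMv false (lam : ℝ≥0)) ∧
          (∀ t' : ℝ≥0, t' = ((lam : ℝ≥0) - z) + ((μ - 1 : ℕ) : ℝ≥0) * (lam : ℝ≥0) →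
            (((π.m1 n).1 - t' < (lam : ℝ≥0) ∨ p (π.s n).1 % 2 = 0) →
              π'.m1 (f n + 2 * μ) = ((π.m1 n).1 - t', (π.m1 n).2.map Sum.inl)) ∧
            (¬ ((π.m1 n).1 - t' < (lam : ℝ≥0) ∨ p (π.s n).1 % 2 = 0) →
              π'.m1 (f n + 2 * μ) = betaMv true (lam : ℝ≥0)) ∧
            (((π.m2 n).1 - t' < (lam : ℝ≥0) ∨ p (π.s n).1 % 2 = 0) →
              π'.m2 (f n + 2 * μ) = ((π.m2 n).1 - t', (π.m2 n).2.map Sum.inl)) ∧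
            (¬ ((π.m2 n).1 - t' < (lam : ℝ≥0) ∨ p (π.s n).1 % 2 = 0) →
              π'.m2 (f n + 2 * μ) = betaMv false (lam : ℝ≥0)))))

/-- `π'` is the expansion `Ex(π)` of the play `π`, presented relationally:
`π'` is a play of the expanded game `G(p, λ)`, and there is an alignment
function `f` matching each step of `π` with the corresponding segment of `π'`
according to the inductive definition of the expansion mapping. -/
def IsExpansion (G : TG L C Act) (d : ℕ) (p : L → ℕ) (lam : ℕ)
    (π : RawPlay L C Act) (π' : RawPlay (ExpLoc L) (ExpClock C) (ExpAct Act)) : Prop :=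
  (expTG G d p lam).IsPlay π' ∧
  ∃ f : ℕ → ℕ, f 0 = 0 ∧ StrictMono f ∧
    (π'.s 0).1.2 = some (p (π.s 0).1) ∧ (π'.s 0).2 none = 0 ∧
    (∀ n, (π'.s (f n)).1.1 = (π.s n).1 ∧ (π'.s (f n)).1.2 ≠ none ∧
          (∀ c : C, (π'.s (f n)).2 (some c) = (π.s n).2 c)) ∧
    (∀ n, ExStep p lam π π' f n)

/-- The finite-play version of `IsExpansion`: the first `N` steps of `π'` form
the expansion of the finite play consisting of the first `n` steps of `π`. -/
def IsExpansionUpTo (G : TG L C Act) (d : ℕ) (p : L → ℕ) (lam : ℕ)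
    (π : RawPlay L C Act) (π' : RawPlay (ExpLoc L) (ExpClock C) (ExpAct Act))
    (n N : ℕ) : Prop :=
  (expTG G d p lam).IsPlayUpTo π' N ∧
  ∃ f : ℕ → ℕ, f 0 = 0 ∧ StrictMono f ∧ f n = N ∧
    (π'.s 0).1.2 = some (p (π.s 0).1) ∧ (π'.s 0).2 none = 0 ∧
    (∀ k ≤ n, (π'.s (f k)).1.1 = (π.s k).1 ∧ (π'.s (f k)).1.2 ≠ none ∧
          (∀ c : C, (π'.s (f k)).2 (some c) = (π.s k).2 c)) ∧
    (∀ k < n, ExStep p lam π π' f k)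

/-! ### Strategies -/

/-- A strategy: given the length `n` of the history and a play (of which only
the first `n` steps are meaningful), produce a move. -/
abbrev Strategy (L C Act : Type) := ℕ → RawPlay L C Act → Mv Act

/-- A strategy depends only on the (relevant prefix of the) history. -/
def PrefixDep (σ : Strategy L C Act) : Prop :=
  ∀ n (π π' : RawPlay L C Act), (∀ k ≤ n, π.s k = π'.s k) →
    (∀ k < n, π.m1 k = π'.m1 k ∧ π.m2 k = π'.m2 k) → σ n π = σ n π'

/-- A move-independent strategy: it depends only on the sequence of states. -/
def MoveIndep (σ : Strategy L C Act) : Prop :=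
  ∀ n (π π' : RawPlay L C Act), (∀ k ≤ n, π.s k = π'.s k) → σ n π = σ n π'

/-- `σ` is a valid player-1 strategy in `G`. -/
def IsStrategy1 (G : TG L C Act) (σ : Strategy L C Act) : Prop :=
  PrefixDep σ ∧ ∀ n π, G.IsPlayUpTo π n → G.Move1 (π.s n) (σ n π)

/-- The play `π` is consistent with the player-1 strategy `σ`. -/
def Consistent1 (σ : Strategy L C Act) (π : RawPlay L C Act) : Prop :=
  ∀ n, π.m1 n = σ n π

/-- Player 1 is not responsible for the transition at step `n` of `π`. -/
def NotResp1 (G : TG L C Act) (π : RawPlay L C Act) (n : ℕ) : Prop :=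
  (π.m2 n).1 < (π.m1 n).1 ∨
  ((π.m1 n).1 = (π.m2 n).1 ∧ ¬ G.ta.Trans (π.s n) (π.m1 n) (π.s (n + 1)))

/-- A play is `P₁`-blameless if from some step on, player 1 is never
responsible for the transition. -/
def Blameless1 (G : TG L C Act) (π : RawPlay L C Act) : Prop :=
  ∃ N, ∀ n ≥ N, NotResp1 G π n

/-- `σ` is a winning player-1 strategy from `s0` for the objective `Ψ`:
every consistent play from `s0` is either time-divergent and in `Ψ`, or
time-convergent and `P₁`-blameless. -/
def Winning1 (G : TG L C Act) (σ : Strategy L C Act) (Ψ : Set (Trace L C))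
    (s0 : L × Val C) : Prop :=
  IsStrategy1 G σ ∧ ∀ π : RawPlay L C Act, G.IsPlay π → π.s 0 = s0 → Consistent1 σ π →
    (TimeDiv G.ta.gamma π.trace ∧ π.trace ∈ Ψ) ∨
    (¬ TimeDiv G.ta.gamma π.trace ∧ Blameless1 G π)

/-! ### The multi-dimensional expanded automaton -/

/-- Locations of the multi-dimensional expanded automaton. -/
abbrev MExpLoc (L : Type) (k : ℕ) := L × Option (Fin k → ℕ)
/-- Clocks of the multi-dimensional expanded automaton: `Sum.inr i` is `z_i`. -/
abbrev MExpClock (C : Type) (k : ℕ) := C ⊕ Fin k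

/-- The update function for vectors of priorities. -/
def mUp {k : ℕ} (q : Fin k → ℕ) (p : L → Fin k → ℕ) (ℓ : L) : Fin k → ℕ :=
  fun i => if q i % 2 = 1 then min (q i) (p ℓ i) else p ℓ i

/-- The multi-dimensional expanded timed automaton `A(p, λ)` for a
`k`-dimensional priority function with priorities in `{0, …, d-1}`. -/
def mExpTA (A : TA L C Act) (k d : ℕ) (hk : 0 < k) (p : L → Fin k → ℕ)
    (lam : Fin k → ℕ) : TA (MExpLoc L k) (MExpClock C k) (ExpAct Act) where
  init := (A.init, some (p A.init))
  gamma := Sum.inl A.gamma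
  inv := fun lq =>
    match lq.2 with
    | some q => liftCC Sum.inl (A.inv lq.1) ++
        ((List.finRange k).filter (fun i => decide (q i % 2 = 1))).map
          (fun i => ⟨Sum.inr i, Cmp.le, lam i⟩)
    | none => [⟨Sum.inr ⟨0, hk⟩, Cmp.le, 0⟩, ⟨Sum.inr ⟨0, hk⟩, Cmp.ge, 0⟩]
  edges :=
    {e : Edge (MExpLoc L k) (MExpClock C k) (ExpAct Act) |
      ∃ q : Fin k → ℕ, (∀ i, q i < d) ∧ ∃ e₀ ∈ A.edges,
        e = ⟨(e₀.src, some q),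
             liftCC Sum.inl e₀.guard ++
               ((List.finRange k).filter (fun i => decide (q i % 2 = 1))).map
                 (fun i => ⟨Sum.inr i, Cmp.lt, lam i⟩),
             Sum.inl e₀.act,
             (Sum.inl '' e₀.resets) ∪ (Sum.inr '' {i : Fin k | ¬ q i % 2 = 1}),
             (e₀.tgt, some (mUp q p e₀.tgt))⟩} ∪
    {e : Edge (MExpLoc L k) (MExpClock C k) (ExpAct Act) |
      ∃ q : Fin k → ℕ, (∀ i, q i < d) ∧ ∃ (ℓ : L) (i : Fin k) (b : Bool), q i % 2 = 1 ∧
        e = ⟨(ℓ, some q),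
             [⟨Sum.inr i, Cmp.le, lam i⟩, ⟨Sum.inr i, Cmp.ge, lam i⟩] ++
               ((List.finRange k).filter (fun j => decide (j < i ∧ q j % 2 = 1))).map
                 (fun j => ⟨Sum.inr j, Cmp.lt, lam j⟩),
             Sum.inr b, Sum.inr '' (Set.univ : Set (Fin k)), (ℓ, none)⟩} ∪
    {e : Edge (MExpLoc L k) (MExpClock C k) (ExpAct Act) |
      ∃ (ℓ : L) (b : Bool), e = ⟨(ℓ, none), [], Sum.inr b, ∅, (ℓ, some (p ℓ))⟩}

/-- The multi-dimensional expanded timed game `G(p, λ)`. -/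
def mExpTG (G : TG L C Act) (k d : ℕ) (hk : 0 < k) (p : L → Fin k → ℕ)
    (lam : Fin k → ℕ) : TG (MExpLoc L k) (MExpClock C k) (ExpAct Act) :=
  ⟨mExpTA G.ta k d hk p lam,
   fun a => match a with | Sum.inl a => G.isP1 a | Sum.inr b => b = true⟩

/-- The set of bad locations of the multi-dimensional expanded automaton. -/
def MBadLocs (L : Type) (k : ℕ) : Set (MExpLoc L k) := {lq | lq.2 = none}

/-- The generalized timed window objective `GTW(p, λ)`. -/
def GTW (γ : C) {k : ℕ} (p : L → Fin k → ℕ) (lam : Fin k → ℕ) : Set (Trace L C) :=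
  {τ | ∀ i : Fin k, τ ∈ TW γ (fun ℓ => p ℓ i) (lam i)}

/-- The generalized direct timed window objective `GDTW(p, λ)`. -/
def GDTW (γ : C) {k : ℕ} (p : L → Fin k → ℕ) (lam : Fin k → ℕ) : Set (Trace L C) :=
  {τ | ∀ i : Fin k, τ ∈ DTW γ (fun ℓ => p ℓ i) (lam i)}

end TWPaper
namespace TWPaper

/-! ### Windows of a trace -/

/-- A window is good iff the least priority seen so far is attained, at an even value, in
less than `lam` time units. -/
lemma mem_TGW_iff {γ : C} {p : L → ℕ} {lam : ℕ} {τ : Trace L C}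
    (hmono : Monotone fun n => (τ.st n).2 γ) :
    τ ∈ TGW γ p lam ↔ ∃ k, Even (p (τ.st k).1) ∧ (∀ i ≤ k, p (τ.st k).1 ≤ p (τ.st i).1) ∧
      (τ.st k).2 γ < (τ.st 0).2 γ + lam := by
  constructor
  · rintro ⟨j, hj, hlt⟩
    have hne : ((fun k => p (τ.st k).1) '' Set.Icc 0 j).Nonempty :=
      ⟨_, 0, by simp, rfl⟩
    obtain ⟨k, hk, hkmin⟩ := Nat.sInf_mem hne
    have hkmin' : p (τ.st k).1 = minPrioIcc p τ 0 j := hkmin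
    refine ⟨k, hkmin' ▸ hj, fun i hi => ?_, ?_⟩
    · rw [hkmin']
      exact Nat.sInf_le ⟨i, ⟨Nat.zero_le _, hi.trans hk.2⟩, rfl⟩
    · exact (hmono hk.2).trans_lt ((tsub_lt_iff_left (hmono (Nat.zero_le j))).1 hlt)
  · rintro ⟨k, hk, hmin, hlt⟩
    refine ⟨k, ?_, (tsub_lt_iff_left (hmono (Nat.zero_le k))).2 hlt⟩
    have : minPrioIcc p τ 0 k = p (τ.st k).1 := by
      refine IsLeast.csInf_eq ⟨⟨k, by simp, rfl⟩, ?_⟩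
      rintro _ ⟨i, hi, rfl⟩
      exact hmin i hi.2
    rwa [this]

lemma Trace.suffix_eq (τ : Trace L C) (n : ℕ) :
    τ.suffix n = ⟨fun k => τ.st (n + k), fun k => τ.dl (n + k)⟩ := by
  unfold Trace.suffix Trace.delayedSuffix
  congr 1
  · funext k
    by_cases hk : k = 0
    · subst hk
      exact Prod.ext rfl (funext fun c => add_zero _)
    · simp [hk]
  · funext k
    by_cases hk : k = 0
    · subst hk
      simp
    · simp [hk]

lemma Trace.suffix_delayedSuffix (τ : Trace L C) (n m : ℕ) (d : ℝ≥0) :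
    (τ.suffix n).delayedSuffix m d = τ.delayedSuffix (n + m) d := by
  rw [Trace.suffix_eq]
  simp [Trace.delayedSuffix, Nat.add_assoc]

lemma delayedSuffix_mem_TGW_iff {γ : C} {p : L → ℕ} {lam : ℕ} {τ : Trace L C}
    (hγ : ∀ n, (τ.st (n + 1)).2 γ = (τ.st n).2 γ + τ.dl n) {m : ℕ} {d : ℝ≥0}
    (hd : d ≤ τ.dl m) :
    τ.delayedSuffix m d ∈ TGW γ p lam ↔ ∃ k ≥ m, Even (p (τ.st k).1) ∧
      (∀ i, m ≤ i → i ≤ k → p (τ.st k).1 ≤ p (τ.st i).1) ∧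
      (k = m ∨ (τ.st k).2 γ < (τ.st m).2 γ + d + lam) ∧ lam ≠ 0 := by
  have hloc : ∀ k, ((τ.delayedSuffix m d).st k).1 = (τ.st (m + k)).1 := by
    intro k
    by_cases hk : k = 0
    · subst hk
      simp [Trace.delayedSuffix]
    · simp [Trace.delayedSuffix, hk]
  have h0 : ((τ.delayedSuffix m d).st 0).2 γ = (τ.st m).2 γ + d := by
    simp [Trace.delayedSuffix, shift]
  have hs : ∀ k, ((τ.delayedSuffix m d).st (k + 1)).2 γ = (τ.st (m + k + 1)).2 γ := by
    intro k
    simp [Trace.delayedSuffix, Nat.add_assoc]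
  have hmono : Monotone fun n => ((τ.delayedSuffix m d).st n).2 γ := by
    refine monotone_nat_of_le_succ fun n => ?_
    cases n with
    | zero =>
      simp only [h0, hs, hγ]
      exact add_le_add_right hd _
    | succ n =>
      simp only [hs]
      rw [← Nat.add_assoc, hγ (m + n + 1)]
      exact le_self_add
  rw [mem_TGW_iff hmono]
  simp only [hloc, h0]
  constructor
  · rintro ⟨k, hk, hmin, hlt⟩
    have hlam : lam ≠ 0 := by
      rintro rfl
      have := hmono (Nat.zero_le k)
      simp only [h0] at this
      simp only [Nat.cast_zero, add_zero] at hlt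
      exact absurd hlt (not_lt.2 this)
    refine ⟨m + k, Nat.le_add_right _ _, hk, fun i hi hik => ?_, ?_, hlam⟩
    · obtain ⟨i, rfl⟩ := Nat.exists_eq_add_of_le hi
      exact hmin i (by omega)
    · cases k with
      | zero => exact Or.inl rfl
      | succ k => exact Or.inr (by rwa [hs] at hlt)
  · rintro ⟨k, hkm, hk, hmin, hlt, hlam⟩
    obtain ⟨k, rfl⟩ := Nat.exists_eq_add_of_le hkm
    refine ⟨k, hk, fun i hi => hmin _ (by omega) (by omega), ?_⟩
    cases k with
    | zero =>
      rw [h0]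
      exact lt_add_of_pos_right _ (by exact_mod_cast Nat.pos_of_ne_zero hlam)
    | succ k =>
      rw [hs]
      rcases hlt with h | h
      · omega
      · exact h

lemma mem_TW_iff {γ : C} {p : L → ℕ} {lam : ℕ} {τ : Trace L C}
    (hγ : ∀ n, (τ.st (n + 1)).2 γ = (τ.st n).2 γ + τ.dl n) (hlam : lam ≠ 0) :
    τ ∈ TW γ p lam ↔ ∃ N, ∀ m ≥ N, ∀ d ≤ τ.dl m, ∃ k ≥ m, Even (p (τ.st k).1) ∧
      (∀ i, m ≤ i → i ≤ k → p (τ.st k).1 ≤ p (τ.st i).1) ∧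
      (k = m ∨ (τ.st k).2 γ < (τ.st m).2 γ + d + lam) := by
  refine exists_congr fun N => ?_
  have hdl : ∀ n, (τ.suffix N).dl n = τ.dl (N + n) := by simp [Trace.suffix_eq]
  constructor
  · intro h m hm d hd
    obtain ⟨n, rfl⟩ := Nat.exists_eq_add_of_le hm
    have := h n d (by rwa [hdl])
    rw [Trace.suffix_delayedSuffix, delayedSuffix_mem_TGW_iff hγ hd] at this
    obtain ⟨k, h₁, h₂, h₃, h₄, -⟩ := this
    exact ⟨k, h₁, h₂, h₃, h₄⟩
  · intro h n d hd
    rw [hdl] at hd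
    rw [Trace.suffix_delayedSuffix, delayedSuffix_mem_TGW_iff hγ hd]
    obtain ⟨k, h₁, h₂, h₃, h₄⟩ := h (N + n) (Nat.le_add_right _ _) d hd
    exact ⟨k, h₁, h₂, h₃, h₄, hlam⟩

/-! ### Transitions of the expanded automaton -/

lemma TG.JointDest.exists_trans {G : TG L C Act} {s s' : L × Val C} {m₁ m₂ : Mv Act}
    (h : G.JointDest s m₁ m₂ s') : ∃ m, m.1 = min m₁.1 m₂.1 ∧ G.ta.Trans s m s' := by
  rcases h with ⟨h, ht⟩ | ⟨h, ht⟩ | ⟨h, ht | ht⟩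
  · exact ⟨m₁, (min_eq_left h.le).symm, ht⟩
  · exact ⟨m₂, (min_eq_right h.le).symm, ht⟩
  · exact ⟨m₁, by simp [h], ht⟩
  · exact ⟨m₂, by simp [h], ht⟩

lemma TA.Trans.clock_eq {A : TA L C Act} {c : C} (hc : ∀ e ∈ A.edges, c ∉ e.resets)
    {s s' : L × Val C} {m : Mv Act} (h : A.Trans s m s') : s'.2 c = s.2 c + m.1 := by
  obtain ⟨d, a⟩ := m
  obtain ⟨-, h⟩ := h
  cases a with
  | none => rw [h.2]; rfl
  | some a =>
    obtain ⟨e, he, -, -, -, -, hs, -⟩ := h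
    rw [hs, resetV, if_neg (hc e he)]
    rfl

lemma expTA_gamma_not_mem_resets {A : TA L C Act} (hA : ∀ e ∈ A.edges, A.gamma ∉ e.resets)
    (d : ℕ) (p : L → ℕ) (lam : ℕ) :
    ∀ e ∈ (expTA A d p lam).edges, some A.gamma ∉ e.resets := by
  rintro e (((⟨q, -, -, e₀, h₀, rfl⟩ | ⟨q, -, -, e₀, h₀, rfl⟩) | ⟨q, -, -, ℓ, b, rfl⟩) |
    ⟨ℓ, b, rfl⟩)
  · simpa using hA e₀ h₀
  · simpa using hA e₀ h₀
  · simp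
  · simp

section ExpTrans

variable {A : TA L C Act} {d : ℕ} {p : L → ℕ} {lam : ℕ}
  {s s' : ExpLoc L × Val (ExpClock C)} {m : Mv (ExpAct Act)}

lemma expTrans_even {q q' : ℕ} (h : (expTA A d p lam).Trans s m s') (hs : s.1.2 = some q)
    (hq : Even q) (hs' : s'.1.2 = some q') :
    (s'.1.1 = s.1.1 ∧ q' = q) ∨ (q' = p s'.1.1 ∧ s'.2 none = 0) := by
  obtain ⟨t, a⟩ := m
  obtain ⟨-, h⟩ := h
  cases a with
  | none =>
    left
    have h1 : s'.1 = s.1 := h.1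
    rw [h1] at hs' ⊢
    exact ⟨rfl, by simpa [hs] using hs'.symm⟩
  | some a =>
    right
    obtain ⟨e, he, hsrc, -, -, htgt, hv, -⟩ := h
    have hsrc2 : e.src.2 = some q := by rw [hsrc, hs]
    rw [htgt] at hs'
    rw [htgt, hv]
    rcases he with ((⟨r, -, hr, e₀, h₀, rfl⟩ | ⟨r, -, hr, e₀, h₀, rfl⟩) |
      ⟨r, -, hr, ℓ, b, rfl⟩) | ⟨ℓ, b, rfl⟩
    · exact ⟨(Option.some.inj hs').symm, by simp [resetV]⟩
    · obtain rfl : r = q := Option.some.inj hsrc2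
      rw [Nat.even_iff] at hq
      omega
    · exact absurd hs' (by simp)
    · exact absurd hsrc2 (by simp)

lemma expTrans_odd {q q' : ℕ} (h : (expTA A d p lam).Trans s m s') (hs : s.1.2 = some q)
    (hq : ¬ Even q) (hs' : s'.1.2 = some q') :
    s'.2 none = s.2 none + m.1 ∧ ((s'.1.1 = s.1.1 ∧ q' = q) ∨ q' = min q (p s'.1.1)) := by
  obtain ⟨t, a⟩ := m
  obtain ⟨-, h⟩ := h
  cases a with
  | none =>
    have h1 : s'.1 = s.1 := h.1
    have h2 : s'.2 = shift s.2 t := h.2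
    rw [h1] at hs' ⊢
    exact ⟨by rw [h2]; rfl, Or.inl ⟨rfl, by simpa [hs] using hs'.symm⟩⟩
  | some a =>
    obtain ⟨e, he, hsrc, -, -, htgt, hv, -⟩ := h
    have hsrc2 : e.src.2 = some q := by rw [hsrc, hs]
    rw [htgt] at hs'
    rw [htgt, hv]
    rcases he with ((⟨r, -, hr, e₀, h₀, rfl⟩ | ⟨r, -, hr, e₀, h₀, rfl⟩) |
      ⟨r, -, hr, ℓ, b, rfl⟩) | ⟨ℓ, b, rfl⟩
    · obtain rfl : r = q := Option.some.inj hsrc2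
      rw [Nat.even_iff] at hq
      omega
    · obtain rfl : r = q := Option.some.inj hsrc2
      exact ⟨by simp [resetV, shift], Or.inr (Option.some.inj hs').symm⟩
    · exact absurd hs' (by simp)
    · exact absurd hsrc2 (by simp)

lemma expTrans_bad {q' : ℕ} (h : (expTA A d p lam).Trans s m s') (hs : s.1.2 = none)
    (hs' : s'.1.2 = some q') : q' = p s'.1.1 ∧ s'.2 none = 0 := by
  obtain ⟨t, a⟩ := m
  obtain ⟨hinv, h⟩ := h
  have hz : s.2 none + t = 0 := by
    have : (⟨none, Cmp.le, 0⟩ : Atom (ExpClock C)).sat (shift s.2 t) :=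
      hinv _ (by simp [expTA, hs])
    simpa [Atom.sat, shift] using this
  cases a with
  | none =>
    have h1 : s'.1 = s.1 := h.1
    rw [h1, hs] at hs'
    exact absurd hs' (by simp)
  | some a =>
    obtain ⟨e, he, hsrc, -, -, htgt, hv, -⟩ := h
    have hsrc2 : e.src.2 = none := by rw [hsrc, hs]
    rw [htgt] at hs'
    rw [htgt, hv]
    rcases he with ((⟨r, -, hr, e₀, h₀, rfl⟩ | ⟨r, -, hr, e₀, h₀, rfl⟩) |
      ⟨r, -, hr, ℓ, b, rfl⟩) | ⟨ℓ, b, rfl⟩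
    · exact absurd hsrc2 (by simp)
    · exact absurd hsrc2 (by simp)
    · exact absurd hsrc2 (by simp)
    · exact ⟨(Option.some.inj hs').symm, by simpa [resetV, shift] using hz⟩

/-- The priority carried by a location of the expanded automaton is at most that of the
underlying location, with equality when it is even. -/
def PrioConsistent (p : L → ℕ) (lq : ExpLoc L) : Prop :=
  ∀ q, lq.2 = some q → q ≤ p lq.1 ∧ (Even q → q = p lq.1)

lemma PrioConsistent.trans (hs : PrioConsistent p s.1) (h : (expTA A d p lam).Trans s m s') :
    PrioConsistent p s'.1 := by
  intro q' hq'
  cases hq : s.1.2 with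
  | none =>
    obtain ⟨h, -⟩ := expTrans_bad h hq hq'
    exact ⟨h.le, fun _ => h⟩
  | some q =>
    obtain ⟨h1, h2⟩ := hs q hq
    by_cases he : Even q
    · rcases expTrans_even h hq he hq' with ⟨hl, rfl⟩ | ⟨h, -⟩
      · rw [hl]
        exact ⟨h1, h2⟩
      · exact ⟨h.le, fun _ => h⟩
    · rcases (expTrans_odd h hq he hq').2 with ⟨hl, rfl⟩ | h
      · rw [hl]
        exact ⟨h1, h2⟩
      · refine ⟨h ▸ min_le_right _ _, fun he' => ?_⟩
        rcases min_choice q (p s'.1.1) with h3 | h3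
        · exact absurd (h3 ▸ h ▸ he') he
        · exact h.trans h3

end ExpTrans

/-! ### The combinatorial core -/

/-- The evolution of the window priority `q` and window clock `z` along a sequence of
priorities `P` with delays `D`. A window that stays bad for `lam` time units during step `n`
is restarted during that step, after `t` time units for the last time. -/
def WindowStep (P q : ℕ → ℕ) (D z : ℕ → ℝ) (lam : ℝ) (n : ℕ) : Prop :=
  (Even (q n) → q (n + 1) = P (n + 1) ∧ (¬ Even (q (n + 1)) → z (n + 1) = 0)) ∧
  (¬ Even (q n) → z n + D n < lam →
    q (n + 1) = min (q n) (P (n + 1)) ∧ z (n + 1) = z n + D n) ∧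
  (¬ Even (q n) → lam ≤ z n + D n →
    (Even (P n) → q (n + 1) = P (n + 1) ∧ (¬ Even (q (n + 1)) → z (n + 1) = 0)) ∧
    (¬ Even (P n) → ∃ t, 0 ≤ t ∧ t ≤ D n ∧
      q (n + 1) = min (P n) (P (n + 1)) ∧ z (n + 1) = D n - t))

section Core

variable {P q : ℕ → ℕ} {g D z : ℕ → ℝ} {lam : ℝ}

/-- The current window closes in time. -/
def Closes (P q : ℕ → ℕ) (g z : ℕ → ℝ) (lam : ℝ) (n : ℕ) : Prop :=
  Even (q n) ∨ ∃ k ≥ n, Even (P k) ∧ P k ≤ q n ∧ (∀ i, n ≤ i → i ≤ k → P k ≤ P i) ∧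
    z n + g k - g n < lam

lemma closes_of_fresh {n : ℕ} (hlam : 0 < lam) (hq : q n = P n)
    (hz : ¬ Even (q n) → z n = 0)
    (hgood : ∃ k ≥ n, Even (P k) ∧ (∀ i, n ≤ i → i ≤ k → P k ≤ P i) ∧
      (k = n ∨ g k < g n + lam)) : Closes P q g z lam n := by
  by_cases he : Even (q n)
  · exact Or.inl he
  · obtain ⟨k, hk, hk2, hmin, hlt⟩ := hgood
    refine Or.inr ⟨k, hk, hk2, hq ▸ hmin n le_rfl hk, hmin, ?_⟩
    rw [hz he]
    rcases hlt with rfl | h <;> linarith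

/-- A window sequence has eventually only good windows iff it is eventually never restarted
because of a bad window. -/
lemma eventually_good_iff (hlam : 0 < lam) (hD : ∀ n, 0 ≤ D n) (hz : ∀ n, 0 ≤ z n)
    (hg : ∀ n, g (n + 1) = g n + D n) (hdiv : ∀ B, ∃ j, B < g j)
    (hqle : ∀ n, q n ≤ P n) (hqeq : ∀ n, Even (q n) → q n = P n)
    (hstep : ∀ n, WindowStep P q D z lam n) :
    (∃ N, ∀ m ≥ N, ∀ d, 0 ≤ d → d ≤ D m → ∃ k ≥ m, Even (P k) ∧
      (∀ i, m ≤ i → i ≤ k → P k ≤ P i) ∧ (k = m ∨ g k < g m + d + lam)) ↔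
    ∃ N, ∀ n ≥ N, ¬ Even (q n) → z n + D n < lam := by
  have hmono : Monotone g := monotone_nat_of_le_succ fun n => by
    rw [hg]; linarith [hD n]
  constructor
  · rintro ⟨N, hN⟩
    have hfresh : ∀ n ≥ N, q (n + 1) = P (n + 1) → (¬ Even (q (n + 1)) → z (n + 1) = 0) →
        Closes P q g z lam (n + 1) := fun n hn h1 h2 => by
      refine closes_of_fresh hlam h1 h2 ?_
      simpa using hN (n + 1) (by omega) 0 le_rfl (hD _)
    have hgap : ∀ n, Closes P q g z lam n → ¬ Even (q n) → z n + D n < lam := by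
      rintro n (h | ⟨k, hk, hk2, hkq, hmin, hlt⟩) he
      · exact absurd h he
      · have hkn : k ≠ n := by
          rintro rfl
          exact he (le_antisymm (hqle k) hkq ▸ hk2)
        have := hmono (show n + 1 ≤ k by omega)
        rw [hg] at this
        linarith
    have hsucc : ∀ n ≥ N, Closes P q g z lam n → Closes P q g z lam (n + 1) := by
      intro n hn hc
      obtain ⟨h1, h2, -⟩ := hstep n
      by_cases he : Even (q n)
      · exact hfresh n hn (h1 he).1 (h1 he).2
      · obtain ⟨hq', hz'⟩ := h2 he (hgap n hc he)
        rcases hc with h | ⟨k, hk, hk2, hkq, hmin, hlt⟩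
        · exact absurd h he
        · have hkn : k ≠ n := by
            rintro rfl
            exact he (le_antisymm (hqle k) hkq ▸ hk2)
          refine Or.inr ⟨k, by omega, hk2, ?_, fun i hi hik => hmin i (by omega) hik, ?_⟩
          · rw [hq']
            exact le_min hkq (hmin _ (by omega) (by omega))
          · rw [hz', hg]
            linarith
    by_cases hbad : ∃ n ≥ N, ¬ Even (q n) ∧ lam ≤ z n + D n
    · obtain ⟨n, hn, he, hle⟩ := hbad
      obtain ⟨-, -, h3⟩ := hstep n
      obtain ⟨h3, h4⟩ := h3 he hle
      have hbase : Closes P q g z lam (n + 1) := by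
        by_cases hP : Even (P n)
        · exact hfresh n hn (h3 hP).1 (h3 hP).2
        · obtain ⟨t, ht0, ht, hq', hz'⟩ := h4 hP
          obtain ⟨k, hk, hk2, hmin, hlt⟩ := hN n hn t ht0 ht
          have hkn : k ≠ n := by
            rintro rfl
            exact hP hk2
          refine Or.inr ⟨k, by omega, hk2, ?_, fun i hi hik => hmin i (by omega) hik, ?_⟩
          · rw [hq']
            exact le_min (hmin _ le_rfl hk) (hmin _ (by omega) (by omega))
          · rw [hz', hg]
            linarith [hlt.resolve_left hkn]
      refine ⟨n + 1, fun m hm => hgap m ?_⟩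
      induction m, hm using Nat.le_induction with
      | base => exact hbase
      | succ m hm ih => exact hsucc m (by omega) ih
    · push Not at hbad
      exact ⟨N, hbad⟩
  · rintro ⟨N, hN⟩
    refine ⟨N, fun m hm d hd0 hdm => ?_⟩
    have hex : ∃ j, m ≤ j ∧ Even (q j) := by
      by_contra! hodd
      have hz' : ∀ j ≥ m, z j = z m + g j - g m := by
        intro j hj
        induction j, hj using Nat.le_induction with
        | base => ring
        | succ j hj ih =>
          have ho : ¬ Even (q j) := hodd j hj
          rw [((hstep j).2.1 ho (hN j (by omega) ho)).2, ih, hg]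
          ring
      obtain ⟨j, hj⟩ := hdiv (g m + lam)
      have hmj : m ≤ j := by
        by_contra! h
        linarith [hmono h.le]
      linarith [hz' j hmj, hN j (by omega) (hodd j hmj), hD j, hz m]
    classical
    obtain ⟨hmj, hj2⟩ := Nat.find_spec hex
    have hlt : ∀ i, m ≤ i → i < Nat.find hex → ¬ Even (q i) := fun i hi hij h =>
      Nat.find_min hex hij ⟨hi, h⟩
    generalize Nat.find hex = j at *
    have hinv : ∀ i, m ≤ i → i ≤ j → (∀ l, m ≤ l → l ≤ i → q i ≤ P l) ∧
        (m < i → g i < g m + lam ∧ (¬ Even (q i) → z i = z m + g i - g m)) ∧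
        (i = m → z i = z m) := by
      intro i hi
      induction i, hi using Nat.le_induction with
      | base =>
        intro _
        refine ⟨fun l h1 h2 => ?_, fun h => absurd h (lt_irrefl _), fun _ => rfl⟩
        obtain rfl := le_antisymm h1 h2
        exact hqle _
      | succ i hi ih =>
        intro hij
        obtain ⟨h1, h2, h3⟩ := ih (by omega)
        have ho := hlt i hi (by omega)
        have hb := hN i (by omega) ho
        obtain ⟨hq', hz'⟩ := (hstep i).2.1 ho hb
        have hzi : z i = z m + g i - g m := by
          rcases hi.eq_or_lt with rfl | h
          · ring
          · exact (h2 h).2 ho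
        refine ⟨fun l hl hli => ?_, fun _ => ⟨?_, fun _ => ?_⟩, fun h => by omega⟩
        · rcases Nat.lt_or_ge l (i + 1) with h | h
          · exact (hq' ▸ min_le_left _ _).trans (h1 l hl (by omega))
          · obtain rfl : l = i + 1 := by omega
            exact hqle _
        · rw [hg]
          linarith [hz m]
        · rw [hz', hg]
          linarith
    obtain ⟨h1, h2, -⟩ := hinv j hmj le_rfl
    have hPj := hqeq j hj2
    refine ⟨j, hmj, hPj ▸ hj2, fun i hi hij => hPj ▸ h1 i hi hij, ?_⟩
    rcases hmj.eq_or_lt with rfl | h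
    · exact Or.inl rfl
    · exact Or.inr (by linarith [(h2 h).1])

end Core

/-! ### Steps of the expansion -/

section Expansion

variable {G : TG L C Act} {d : ℕ} {p : L → ℕ} {lam : ℕ} {π : RawPlay L C Act}
  {π' : RawPlay (ExpLoc L) (ExpClock C) (ExpAct Act)} {f : ℕ → ℕ}

lemma expTG_exists_trans (h : (expTG G d p lam).IsPlay π') (i : ℕ) :
    ∃ m, (expTA G.ta d p lam).Trans (π'.s i) m (π'.s (i + 1)) := by
  obtain ⟨m, -, h⟩ := (h i).2.2.exists_trans
  exact ⟨m, h⟩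

lemma prioConsistent_of_isPlay (h : (expTG G d p lam).IsPlay π')
    (h0 : PrioConsistent p (π'.s 0).1) (i : ℕ) : PrioConsistent p (π'.s i).1 := by
  induction i with
  | zero => exact h0
  | succ i ih =>
    obtain ⟨m, hm⟩ := expTG_exists_trans h i
    exact ih.trans hm

lemma TG.IsPlay.gamma_succ (hπ : G.IsPlay π) (hwf : G.ta.WellFormed) (n : ℕ) :
    (π.s (n + 1)).2 G.ta.gamma = (π.s n).2 G.ta.gamma + π.delay n := by
  obtain ⟨m, hm, h⟩ := (hπ n).2.2.exists_trans
  rw [h.clock_eq hwf.1, hm]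
  rfl

lemma expTG_gamma_monotone (h : (expTG G d p lam).IsPlay π') (hwf : G.ta.WellFormed) :
    Monotone fun i => (π'.s i).2 (some G.ta.gamma) := by
  refine monotone_nat_of_le_succ fun i => ?_
  obtain ⟨m, hm⟩ := expTG_exists_trans h i
  rw [hm.clock_eq (expTA_gamma_not_mem_resets hwf.1 d p lam)]
  exact le_self_add

lemma windowStep_of_exStep (hwf : G.ta.WellFormed) (hπ : G.IsPlay π)
    (hπ' : (expTG G d p lam).IsPlay π') {q : ℕ → ℕ}
    (hq : ∀ n, (π'.s (f n)).1.2 = some (q n))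
    (hloc : ∀ n, (π'.s (f n)).1.1 = (π.s n).1)
    (hclk : ∀ n, (π'.s (f n)).2 (some G.ta.gamma) = (π.s n).2 G.ta.gamma)
    (hqle : ∀ n, q n ≤ p (π.s n).1) (hqeq : ∀ n, Even (q n) → q n = p (π.s n).1)
    {n : ℕ} (hstep : ExStep p lam π π' f n) :
    WindowStep (fun n => p (π.s n).1) q (fun n => (π.delay n : ℝ))
      (fun n => ((π'.s (f n)).2 none : ℝ)) lam n := by
  obtain ⟨q₀, hq₀, hstep⟩ := hstep
  obtain rfl : q n = q₀ := Option.some.inj ((hq n).symm.trans hq₀)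
  obtain ⟨hA, hB⟩ := hstep _ _ rfl rfl
  have hγ := hπ.gamma_succ hwf n
  have hres := expTA_gamma_not_mem_resets hwf.1 d p lam
  have hmod : ∀ k : ℕ, ¬ Even k → k % 2 = 1 := fun k hk => Nat.odd_iff.1 (Nat.not_even_iff_odd.1 hk)
  have hev : ∀ i r, (π'.s i).1 = ((π.s n).1, some r) → Even r → r = p (π.s n).1 →
      f (n + 1) = i + 1 →
      q (n + 1) = p (π.s (n + 1)).1 ∧
        (¬ Even (q (n + 1)) → ((π'.s (f (n + 1))).2 none : ℝ) = 0) := by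
    intro i r hi hr hrp hf
    obtain ⟨m, hm⟩ := expTG_exists_trans hπ' i
    rw [← hf] at hm
    rcases expTrans_even hm (by rw [hi]) hr (hq (n + 1)) with ⟨-, h⟩ | ⟨h1, h2⟩
    · rw [h]
      exact ⟨by rw [← h]; exact hqeq _ (h ▸ hr), fun h' => absurd hr h'⟩
    · rw [hloc] at h1
      exact ⟨h1, fun _ => by rw [h2]; rfl⟩
  have hod : ∀ i r, (π'.s i).1 = ((π.s n).1, some r) → ¬ Even r → r ≤ p (π.s n).1 →
      f (n + 1) = i + 1 →
      q (n + 1) = min r (p (π.s (n + 1)).1) ∧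
        (π'.s (f (n + 1))).2 none + (π'.s i).2 (some G.ta.gamma) =
          (π'.s i).2 none + (π.s (n + 1)).2 G.ta.gamma := by
    intro i r hi hr hrp hf
    obtain ⟨m, hm⟩ := expTG_exists_trans hπ' i
    rw [← hf] at hm
    have hc := hm.clock_eq hres
    rw [hclk] at hc
    obtain ⟨hz, h⟩ := expTrans_odd hm (by rw [hi]) hr (hq (n + 1))
    refine ⟨?_, by rw [hz, hc]; ring⟩
    rcases h with ⟨-, h⟩ | h
    · have := hqle (n + 1)
      omega
    · rw [h, hloc]
  have hfn : (π'.s (f n)).1 = ((π.s n).1, some (q n)) := Prod.ext (hloc n) (hq n)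
  refine ⟨fun he => ?_, fun ho hlt => ?_, fun ho hle => ?_⟩
  · exact hev (f n) (q n) hfn he (hqeq n he) (hA (Or.inl (Nat.even_iff.1 he))).1
  · have hlt' : (π'.s (f n)).2 none + π.delay n < (lam : ℝ≥0) := by exact_mod_cast hlt
    obtain ⟨h1, h2⟩ := hod (f n) (q n) hfn ho (hqle n) (hA (Or.inr hlt')).1
    refine ⟨h1, ?_⟩
    rw [hclk, hγ] at h2
    have h3 := congrArg NNReal.toReal h2
    push_cast at h3
    linarith
  · have hle' : (lam : ℝ≥0) ≤ (π'.s (f n)).2 none + π.delay n := by exact_mod_cast hle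
    obtain ⟨μ, hμ, -, -, hf, hbad, hgood, -⟩ := hB (hmod _ ho) hle'
    have hi := hgood μ hμ le_rfl
    refine ⟨fun hP => hev _ _ hi hP rfl hf, fun hP => ?_⟩
    obtain ⟨h1, h2⟩ := hod _ _ hi hP le_rfl hf
    have hz0 : (π'.s (f n + 2 * μ)).2 none = 0 := by
      obtain ⟨m, hm⟩ := expTG_exists_trans hπ' (f n + 2 * (μ - 1) + 1)
      have hidx : f n + 2 * (μ - 1) + 1 + 1 = f n + 2 * μ := by omega
      rw [hidx] at hm
      exact (expTrans_bad hm (by rw [hbad _ (by omega)]) (by rw [hi])).2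
    have hmono := expTG_gamma_monotone hπ' hwf
    have hlo : (π.s n).2 G.ta.gamma ≤ (π'.s (f n + 2 * μ)).2 (some G.ta.gamma) := by
      rw [← hclk]
      exact hmono (Nat.le_add_right _ _)
    have hhi : (π'.s (f n + 2 * μ)).2 (some G.ta.gamma) ≤ (π.s (n + 1)).2 G.ta.gamma := by
      rw [← hclk]
      exact hmono (by omega)
    rw [hz0, zero_add] at h2
    rw [hγ] at h2 hhi
    have h3 := congrArg NNReal.toReal h2
    have hlo' := NNReal.coe_le_coe.2 hlo
    have hhi' := NNReal.coe_le_coe.2 hhi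
    push_cast at h3 hhi'
    refine ⟨(π'.s (f n + 2 * μ)).2 (some G.ta.gamma) - (π.s n).2 G.ta.gamma, ?_, ?_, h1, ?_⟩ <;>
      linarith

end Expansion

/-- For every time-divergent play `π` of `G`:
`π ∈ TW(p,λ)` iff its expansion satisfies the co-Büchi objective
`coBüchi(Bad)` in the expanded game `G(p,λ)`, where `Bad = L × {bad}`. -/
theorem statement6 {L C Act : Type} [Finite L] [Finite C] [Finite Act]
    (G : TG L C Act) (hwf : G.ta.WellFormed)
    (d : ℕ) (p : L → ℕ) (hp : ∀ ℓ, p ℓ < d)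
    (lam : ℕ) (hlam : lam ≠ 0)
    (π : RawPlay L C Act) (hπ : G.IsPlay π)
    (hdiv : TimeDiv G.ta.gamma π.trace)
    (π' : RawPlay (ExpLoc L) (ExpClock C) (ExpAct Act))
    (hex : IsExpansion G d p lam π π') :
    π.trace ∈ TW G.ta.gamma p lam ↔ π'.trace ∈ CoBuchiObj (BadLocs L) := by
  obtain ⟨hπ', f, hf0, hfm, hq0, -, hal, hstep⟩ := hex
  have hq : ∀ n, ∃ q, (π'.s (f n)).1.2 = some q := fun n =>
    Option.ne_none_iff_exists'.1 (hal n).2.1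
  choose q hq using hq
  have hloc : ∀ n, (π'.s (f n)).1.1 = (π.s n).1 := fun n => (hal n).1
  have hcons : ∀ i, PrioConsistent p (π'.s i).1 := by
    refine prioConsistent_of_isPlay hπ' fun r hr => ?_
    have h0 := hloc 0
    rw [hf0] at h0
    obtain rfl : p (π.s 0).1 = r := Option.some.inj (hq0.symm.trans hr)
    rw [h0]
    exact ⟨le_rfl, fun _ => rfl⟩
  have hqle : ∀ n, q n ≤ p (π.s n).1 := fun n => hloc n ▸ (hcons (f n) _ (hq n)).1
  have hqeq : ∀ n, Even (q n) → q n = p (π.s n).1 := fun n => hloc n ▸ (hcons (f n) _ (hq n)).2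
  have hγ := hπ.gamma_succ hwf
  have hwin := fun n => windowStep_of_exStep hwf hπ hπ' hq hloc (fun n => (hal n).2.2 _)
    hqle hqeq (hstep n)
  have hcore := eventually_good_iff (g := fun n => ((π.s n).2 G.ta.gamma : ℝ))
    (Nat.cast_pos.2 (Nat.pos_of_ne_zero hlam)) (fun n => NNReal.coe_nonneg _)
    (fun n => NNReal.coe_nonneg _) (fun n => by simp only [hγ]; push_cast; rfl)
    (fun B => by
      obtain ⟨j, hj⟩ := hdiv B.toNNReal
      exact ⟨j, (Real.le_coe_toNNReal B).trans_lt (NNReal.coe_lt_coe.2 hj)⟩)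
    hqle hqeq hwin
  rw [mem_TW_iff hγ hlam]
  refine Iff.trans (exists_congr fun N => ?_) (hcore.trans ?_)
  · refine forall₂_congr fun m _ => ?_
    constructor
    · intro h t ht0 ht
      lift t to ℝ≥0 using ht0
      obtain ⟨k, h1, h2, h3, h4⟩ := h t (by exact_mod_cast ht)
      exact ⟨k, h1, h2, h3, h4.imp id fun h => by exact_mod_cast h⟩
    · intro h t ht
      obtain ⟨k, h1, h2, h3, h4⟩ := h t t.2 (by exact_mod_cast ht)
      exact ⟨k, h1, h2, h3, h4.imp id fun h => by exact_mod_cast h⟩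
  · constructor
    · rintro ⟨N, hN⟩
      have hf1 : ∀ k, f (N + k) = f N + k := by
        intro k
        induction k with
        | zero => rfl
        | succ k ih =>
          obtain ⟨q₀, hq₀, hst⟩ := hstep (N + k)
          obtain rfl : q (N + k) = q₀ := Option.some.inj ((hq _).symm.trans hq₀)
          have hc : q (N + k) % 2 = 0 ∨
              (π'.s (f (N + k))).2 none + π.delay (N + k) < (lam : ℝ≥0) := by
            by_cases he : Even (q (N + k))
            · exact Or.inl (Nat.even_iff.1 he)
            · exact Or.inr (by exact_mod_cast hN (N + k) (Nat.le_add_right _ _) he)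
          have := ((hst _ _ rfl rfl).1 hc).1
          rw [← Nat.add_assoc, this, ih, Nat.add_assoc]
      refine ⟨f N, fun i hi hbad => ?_⟩
      obtain ⟨k, rfl⟩ := Nat.exists_eq_add_of_le hi
      rw [← hf1] at hbad
      exact (hal (N + k)).2.1 hbad
    · rintro ⟨N, hN⟩
      refine ⟨N, fun n hn ho => ?_⟩
      by_contra! hle
      obtain ⟨q₀, hq₀, hst⟩ := hstep n
      obtain rfl : q n = q₀ := Option.some.inj ((hq _).symm.trans hq₀)
      have hle' : (lam : ℝ≥0) ≤ (π'.s (f n)).2 none + π.delay n := by exact_mod_cast hle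
      obtain ⟨μ, hμ, -, -, -, hbad, -⟩ :=
        (hst _ _ rfl rfl).2 (Nat.odd_iff.1 (Nat.not_even_iff_odd.1 ho)) hle'
      have := hfm.le_apply (x := n)
      refine hN (f n + 2 * 0 + 1) (by omega) ?_
      change (π'.s (f n + 2 * 0 + 1)).1.2 = none
      rw [hbad 0 (by omega)]

end TWPaper
end

section
/- For every well-initialized time-divergent infinite play π̄ of the expanded timed game G(p,λ): π̄ satisfies the safety objective Safe(Bad) if and only if its projection Pr(π̄) satisfies the direct timed window objective DTW(p,λ) in G, where Bad = L × {bad}. -/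
open scoped NNReal

namespace TWPaper

lemma TA.Trans.gamma_eq {L C Act : Type} {A : TA L C Act}
    (hγ : ∀ e ∈ A.edges, A.gamma ∉ e.resets) {s s' : L × Val C} {m : Mv Act}
    (h : A.Trans s m s') : s'.2 A.gamma = s.2 A.gamma + m.1 := by
  obtain ⟨t, a⟩ := m
  obtain ⟨-, h⟩ := h
  cases a with
  | none => rw [h.2]; rfl
  | some a =>
    obtain ⟨e, he, -, -, -, -, h, -⟩ := h
    rw [h]
    simp [resetV, hγ e he, shift]

lemma expTA_gamma_notMem_resets {L C Act : Type} {A : TA L C Act}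
    (hγ : ∀ e ∈ A.edges, A.gamma ∉ e.resets) (d : ℕ) (p : L → ℕ) (lam : ℕ) :
    ∀ e ∈ (expTA A d p lam).edges, (expTA A d p lam).gamma ∉ e.resets := by
  rintro e (((⟨q, -, -, e₀, he₀, rfl⟩ | ⟨q, -, -, e₀, he₀, rfl⟩) | ⟨q, -, -, ℓ, b, rfl⟩) |
    ⟨ℓ, b, rfl⟩) <;> simp [expTA]
  · exact hγ e₀ he₀
  · exact hγ e₀ he₀

/-- The transitions of the expanded automaton leaving a location which is not bad:
delays, edges from a closed window, edges from an open window, and edges to a bad location. -/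
lemma expTA_trans_cases {L C Act : Type} {A : TA L C Act} {d : ℕ} {p : L → ℕ} {lam : ℕ}
    {s s' : ExpLoc L × Val (ExpClock C)} {m : Mv (ExpAct Act)}
    (h : (expTA A d p lam).Trans s m s') {q : ℕ} (hq : s.1.2 = some q) :
    (q % 2 = 1 → s.2 none + m.1 ≤ lam) ∧
    ((s'.1 = s.1 ∧ s'.2 none = s.2 none + m.1) ∨
     (q % 2 = 0 ∧ s'.1.2 = some (p s'.1.1) ∧ s'.2 none = 0) ∨
     (q % 2 = 1 ∧ s'.1.2 = some (min q (p s'.1.1)) ∧ s'.2 none = s.2 none + m.1 ∧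
       s'.2 none < lam) ∨
     (q % 2 = 1 ∧ s'.1.2 = none ∧ s.2 none + m.1 = lam)) := by
  obtain ⟨⟨ℓ, o⟩, ν⟩ := s
  obtain ⟨⟨ℓ', o'⟩, ν'⟩ := s'
  obtain ⟨t, a⟩ := m
  obtain rfl : o = some q := hq
  obtain ⟨hinv, h⟩ := h
  constructor
  · intro hodd
    simpa [Atom.sat, shift] using hinv ⟨none, Cmp.le, lam⟩ (by simp [expTA, hodd])
  cases a with
  | none => exact Or.inl ⟨h.1, congrFun h.2 none⟩
  | some a =>
    obtain ⟨e, he, hsrc, -, hg, htgt, hν, -⟩ := h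
    simp only at hν htgt hsrc
    subst hν
    right
    rcases he with ((⟨q', -, hq', e₀, -, rfl⟩ | ⟨q', -, hq', e₀, -, rfl⟩) |
      ⟨q', -, hq', ℓ₁, b, rfl⟩) | ⟨ℓ₁, b, rfl⟩ <;>
      simp only [Prod.mk.injEq, Option.some.injEq, reduceCtorEq, and_false] at hsrc htgt
    · obtain ⟨rfl, rfl⟩ := hsrc
      obtain ⟨rfl, rfl⟩ := htgt
      exact Or.inl ⟨hq', rfl, by simp [resetV]⟩
    · obtain ⟨rfl, rfl⟩ := hsrc
      obtain ⟨rfl, rfl⟩ := htgt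
      have hlt : ν none + t < lam := by
        simpa [Atom.sat, shift] using hg ⟨none, Cmp.lt, lam⟩ (by simp)
      refine Or.inr (Or.inl ⟨hq', rfl, ?_, ?_⟩)
      · simp [resetV, shift]
      · simpa [resetV, shift] using hlt
    · obtain ⟨rfl, rfl⟩ := hsrc
      obtain ⟨rfl, rfl⟩ := htgt
      refine Or.inr (Or.inr ⟨hq', rfl, le_antisymm ?_ ?_⟩)
      · simpa [Atom.sat, shift] using hg ⟨none, Cmp.le, lam⟩ (by simp)
      · simpa [Atom.sat, shift] using hg ⟨none, Cmp.ge, lam⟩ (by simp)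

lemma TG.StepOK.exists_trans {L C Act : Type} {G : TG L C Act} {π : RawPlay L C Act} {n : ℕ}
    (h : G.StepOK π n) : ∃ m : Mv Act, m.1 = π.delay n ∧ G.ta.Trans (π.s n) m (π.s (n + 1)) := by
  unfold RawPlay.delay
  obtain ⟨-, -, ⟨hlt, h⟩ | ⟨hlt, h⟩ | ⟨heq, h | h⟩⟩ := h
  · exact ⟨_, (min_eq_left hlt.le).symm, h⟩
  · exact ⟨_, (min_eq_right hlt.le).symm, h⟩
  · exact ⟨_, (min_eq_left heq.le).symm, h⟩
  · exact ⟨_, (min_eq_right heq.ge).symm, h⟩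

lemma Trace.delayedSuffix_st_fst {L C : Type} (τ : Trace L C) (n : ℕ) (d : ℝ≥0) (k : ℕ) :
    ((τ.delayedSuffix n d).st k).1 = (τ.st (n + k)).1 := by
  by_cases hk : k = 0 <;> simp [Trace.delayedSuffix, hk]

lemma minPrioIcc_delayedSuffix {L C : Type} (p : L → ℕ) (τ : Trace L C) (n : ℕ) (d : ℝ≥0)
    (j : ℕ) : minPrioIcc p (τ.delayedSuffix n d) 0 j = minPrioIcc p τ n (n + j) := by
  unfold minPrioIcc
  congr 1
  ext v
  simp only [Trace.delayedSuffix_st_fst, Set.mem_image, Set.mem_Icc]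
  constructor
  · rintro ⟨k, hk, rfl⟩
    exact ⟨n + k, by omega, rfl⟩
  · rintro ⟨k, hk, rfl⟩
    exact ⟨k - n, by omega, by rw [Nat.add_sub_cancel' hk.1]⟩

lemma minPrioIcc_eq_of_isLeast {L C : Type} {p : L → ℕ} {τ : Trace L C} {a b v : ℕ}
    (h : IsLeast ((fun k => p (τ.st k).1) '' Set.Icc a b) v) : minPrioIcc p τ a b = v :=
  h.csInf_eq

lemma projPlay_mem_DTW_of_safe {L C Act : Type} {G : TG L C Act}
    (hγ : ∀ e ∈ G.ta.edges, G.ta.gamma ∉ e.resets)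
    {d : ℕ} {p : L → ℕ} {lam : ℕ} (hlam : lam ≠ 0)
    {π : RawPlay (ExpLoc L) (ExpClock C) (ExpAct Act)}
    (hπ : (expTG G d p lam).IsPlay π) (hwi : WellInit p π)
    (hdiv : TimeDiv (some G.ta.gamma) π.trace) (hsafe : π.trace ∈ SafeObj (BadLocs L)) :
    (projPlay π).trace ∈ DTW G.ta.gamma p lam := by
  have hex : ∀ n, ∃ q, (π.s n).1.2 = some q := fun n =>
    Option.ne_none_iff_exists'.1 (hsafe n)
  choose q hq using hex
  set ℓ : ℕ → L := fun n => (π.s n).1.1 with hℓ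
  set z : ℕ → ℝ≥0 := fun n => (π.s n).2 none with hz
  set g : ℕ → ℝ≥0 := fun n => (π.s n).2 (some G.ta.gamma) with hg
  have hgs : ∀ n, g (n + 1) = g n + π.delay n := by
    intro n
    obtain ⟨m, hm, ht⟩ := (hπ n).exists_trans
    rw [← hm]
    exact ht.gamma_eq (expTA_gamma_notMem_resets hγ d p lam)
  have hgm : Monotone g := monotone_nat_of_le_succ fun n => by rw [hgs]; exact le_self_add
  have hstep : ∀ n, (q n % 2 = 1 → z n + π.delay n ≤ lam) ∧
      ((ℓ (n + 1) = ℓ n ∧ q (n + 1) = q n ∧ z (n + 1) = z n + π.delay n) ∨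
       (q n % 2 = 0 ∧ q (n + 1) = p (ℓ (n + 1))) ∨
       (q n % 2 = 1 ∧ q (n + 1) = min (q n) (p (ℓ (n + 1))) ∧ z (n + 1) = z n + π.delay n ∧
         z (n + 1) < lam)) := by
    intro n
    obtain ⟨m, hm, ht⟩ := (hπ n).exists_trans
    obtain ⟨h₁, h₂⟩ := expTA_trans_cases ht (hq n)
    rw [hm] at h₁ h₂
    refine ⟨h₁, ?_⟩
    rw [hq (n + 1)] at h₂
    rcases h₂ with ⟨h, h'⟩ | ⟨h, h', -⟩ | ⟨h, h', h''⟩ | ⟨-, h, -⟩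
    · refine Or.inl ⟨congrArg Prod.fst h, ?_, h'⟩
      have := congrArg Prod.snd h
      rw [hq, hq] at this
      exact Option.some.inj this
    · exact Or.inr (Or.inl ⟨h, Option.some.inj h'⟩)
    · exact Or.inr (Or.inr ⟨h, Option.some.inj h', h''⟩)
    · cases h
  have hqp : ∀ n, q n ≤ p (ℓ n) ∧ (q n % 2 = 0 → q n = p (ℓ n)) := by
    intro n
    induction n with
    | zero =>
      have : q 0 = p (ℓ 0) := Option.some.inj ((hq 0).symm.trans hwi.1)
      exact ⟨this.le, fun _ => this⟩
    | succ n ih =>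
      rcases (hstep n).2 with ⟨h, h', -⟩ | ⟨-, h⟩ | ⟨h, h', -⟩
      · rw [h, h']; exact ih
      · exact ⟨h.le, fun _ => h⟩
      · omega
  intro n e he
  have hgst : ∀ k, k ≠ 0 → (((projPlay π).trace.delayedSuffix n e).st k).2 G.ta.gamma
      = g (n + k) := by
    intro k hk
    simp [Trace.delayedSuffix, hk, RawPlay.trace, projPlay, projState, hg]
  have hgst0 : (((projPlay π).trace.delayedSuffix n e).st 0).2 G.ta.gamma = g n + e := by
    simp [Trace.delayedSuffix, RawPlay.trace, projPlay, projState, hg, shift]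
  by_cases hodd : p (ℓ n) % 2 = 0
  · refine ⟨0, ?_, ?_⟩
    · rw [minPrioIcc_delayedSuffix,
        minPrioIcc_eq_of_isLeast (v := p (ℓ n)) (by
          simp [hℓ, RawPlay.trace, projPlay, projState])]
      exact Nat.even_iff.2 hodd
    · rw [tsub_self]
      exact_mod_cast Nat.pos_of_ne_zero hlam
  have hqn : q n % 2 = 1 := by
    have := (hqp n).2
    by_contra h
    rw [this (by omega)] at h
    omega
  have key : ∀ i, (∀ k < i, q (n + k) % 2 = 1) →
      z (n + i) + g n = z n + g (n + i) ∧ ∀ k ≤ i, q (n + i) ≤ q (n + k) := by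
    intro i
    induction i with
    | zero => intro _; exact ⟨rfl, fun k hk => by rw [Nat.le_zero.1 hk]⟩
    | succ i ih =>
      intro h
      obtain ⟨ih₁, ih₂⟩ := ih fun k hk => h k (by omega)
      have hi := h i (by omega)
      have hz' : z (n + i + 1) = z (n + i) + π.delay (n + i) := by
        rcases (hstep (n + i)).2 with h' | h' | h'
        · exact h'.2.2
        · omega
        · exact h'.2.2.1
      have hq' : q (n + i + 1) ≤ q (n + i) := by
        rcases (hstep (n + i)).2 with h' | h' | h' <;> omega
      rw [← add_assoc n i 1]
      refine ⟨?_, fun k hk => ?_⟩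
      · rw [hz', hgs, add_right_comm, ih₁, add_assoc]
      · rcases Nat.lt_or_ge i k with h' | h'
        · obtain rfl : k = i + 1 := by omega
          rfl
        · exact hq'.trans (ih₂ k h')
  have hclose : ∃ i, q (n + i) % 2 = 0 := by
    by_contra! hno
    replace hno : ∀ i, q (n + i) % 2 = 1 := fun i => by have := hno i; omega
    obtain ⟨j, hj⟩ := hdiv (lam + g n)
    change lam + g n < g j at hj
    have h₁ := hgm (Nat.le_add_left j n)
    have h₂ := (key j fun k _ => hno k).1
    have h₃ : z (n + j) ≤ lam := le_self_add.trans ((hstep (n + j)).1 (hno j))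
    have h₄ : g (n + j) ≤ lam + g n :=
      calc g (n + j) ≤ z n + g (n + j) := le_add_self
        _ = z (n + j) + g n := h₂.symm
        _ ≤ lam + g n := by gcongr
    exact absurd (hj.trans_le (h₁.trans h₄)) (lt_irrefl _)
  classical
  obtain ⟨j, hj, hmin⟩ : ∃ j, q (n + j) % 2 = 0 ∧ ∀ k < j, q (n + k) % 2 = 1 :=
    ⟨Nat.find hclose, Nat.find_spec hclose, fun k hk => by
      have := Nat.find_min hclose hk; omega⟩
  obtain ⟨hzj, hqj⟩ := key j hmin
  obtain ⟨i, rfl⟩ : ∃ i, j = i + 1 :=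
    Nat.exists_eq_succ_of_ne_zero (by rintro rfl; simp at hj; omega)
  have hlt : z (n + (i + 1)) < lam := by
    have := hmin i (by omega)
    rcases (hstep (n + i)).2 with h' | h' | h'
    · rw [add_assoc] at h'; omega
    · omega
    · exact h'.2.2.2
  refine ⟨i + 1, ?_, ?_⟩
  · rw [minPrioIcc_delayedSuffix, minPrioIcc_eq_of_isLeast (v := q (n + (i + 1)))]
    · exact Nat.even_iff.2 hj
    · refine ⟨⟨n + (i + 1), ⟨by omega, le_rfl⟩, ((hqp _).2 hj).symm⟩, ?_⟩
      rintro _ ⟨k, ⟨hk, hk'⟩, rfl⟩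
      obtain ⟨k, rfl⟩ := Nat.exists_eq_add_of_le hk
      exact (hqj k (by omega)).trans (hqp (n + k)).1
  · rw [hgst _ (by omega), hgst0]
    calc g (n + (i + 1)) - (g n + e) ≤ g (n + (i + 1)) - g n :=
          tsub_le_tsub_left le_self_add _
      _ ≤ z (n + (i + 1)) := tsub_le_iff_right.2 (hzj ▸ le_add_self)
      _ < lam := hlt

lemma safe_of_projPlay_mem_DTW {L C Act : Type} {G : TG L C Act}
    (hγ : ∀ e ∈ G.ta.edges, G.ta.gamma ∉ e.resets)
    {d : ℕ} {p : L → ℕ} {lam : ℕ}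
    {π : RawPlay (ExpLoc L) (ExpClock C) (ExpAct Act)}
    (hπ : (expTG G d p lam).IsPlay π) (hwi : WellInit p π)
    (hdtw : (projPlay π).trace ∈ DTW G.ta.gamma p lam) :
    π.trace ∈ SafeObj (BadLocs L) := by
  set ℓ : ℕ → L := fun n => (π.s n).1.1 with hℓ
  set z : ℕ → ℝ≥0 := fun n => (π.s n).2 none with hz
  set g : ℕ → ℝ≥0 := fun n => (π.s n).2 (some G.ta.gamma) with hg
  have hgs : ∀ n, g (n + 1) = g n + π.delay n := by
    intro n
    obtain ⟨m, hm, ht⟩ := (hπ n).exists_trans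
    rw [← hm]
    exact ht.gamma_eq (expTA_gamma_notMem_resets hγ d p lam)
  have hgm : Monotone g := monotone_nat_of_le_succ fun n => by rw [hgs]; exact le_self_add
  have hinv : ∀ k, ∃ q, (π.s k).1.2 = some q ∧ (q % 2 = 1 → ∃ i ≤ k, z k + g i = g k ∧
      IsLeast ((fun n => p (ℓ n)) '' Set.Icc i k) q ∧
      ∀ k', i ≤ k' → k' ≤ k →
        minPrioIcc p (projPlay π).trace i k' % 2 = 1) := by
    have fresh : ∀ k, (π.s k).1.2 = some (p (ℓ k)) → z k = 0 →
        ∃ q, (π.s k).1.2 = some q ∧ (q % 2 = 1 → ∃ i ≤ k, z k + g i = g k ∧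
          IsLeast ((fun n => p (ℓ n)) '' Set.Icc i k) q ∧
          ∀ k', i ≤ k' → k' ≤ k →
            minPrioIcc p (projPlay π).trace i k' % 2 = 1) := by
      intro k h h'
      have hl : IsLeast ((fun n => p (ℓ n)) '' Set.Icc k k) (p (ℓ k)) := by simp
      refine ⟨_, h, fun hodd => ⟨k, le_rfl, by rw [h', zero_add], hl, ?_⟩⟩
      intro k' h₁ h₂
      obtain rfl := le_antisymm h₁ h₂
      rw [minPrioIcc_eq_of_isLeast hl]
      exact hodd
    intro k
    induction k with
    | zero => exact fresh 0 hwi.1 hwi.2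
    | succ k ih =>
      obtain ⟨q, hq, ih⟩ := ih
      have extend : ∀ q', q % 2 = 1 → (π.s (k + 1)).1.2 = some q' →
          q' = min q (p (ℓ (k + 1))) → z (k + 1) = z k + π.delay k →
          ∃ q, (π.s (k + 1)).1.2 = some q ∧ (q % 2 = 1 → ∃ i ≤ k + 1, z (k + 1) + g i = g (k + 1) ∧
          IsLeast ((fun n => p (ℓ n)) '' Set.Icc i (k + 1)) q ∧
          ∀ k', i ≤ k' → k' ≤ k + 1 →
            minPrioIcc p (projPlay π).trace i k' % 2 = 1) := by
        intro q' hodd hq' hmin hz'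
        refine ⟨q', hq', fun hodd' => ?_⟩
        obtain ⟨i, hi, hzi, hl, hk⟩ := ih hodd
        have hl' : IsLeast ((fun n => p (ℓ n)) '' Set.Icc i (k + 1)) q' := by
          have : Set.Icc i (k + 1) = insert (k + 1) (Set.Icc i k) := by
            ext x; simp only [Set.mem_Icc, Set.mem_insert_iff]; omega
          rw [this, Set.image_insert_eq, hmin, min_comm]
          exact hl.insert _
        refine ⟨i, by omega, ?_, hl', fun k' h₁ h₂ => ?_⟩
        · rw [hz', hgs, add_right_comm, hzi]
        · rcases Nat.lt_or_ge k k' with h | h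
          · obtain rfl : k' = k + 1 := by omega
            rw [minPrioIcc_eq_of_isLeast hl']
            exact hodd'
          · exact hk k' h₁ h
      obtain ⟨m, hm, ht⟩ := (hπ k).exists_trans
      obtain ⟨h₁, h₂⟩ := expTA_trans_cases ht hq
      rw [hm] at h₁ h₂
      rcases h₂ with ⟨h, h'⟩ | ⟨-, h, h'⟩ | ⟨hodd, h, h', -⟩ | ⟨hodd, h, h'⟩
      · by_cases hodd : q % 2 = 1
        · refine extend q hodd (by rw [h, hq]) ?_ h'
          obtain ⟨i, hi, -, hl, -⟩ := ih hodd
          have : ℓ (k + 1) = ℓ k := congrArg Prod.fst h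
          rw [this]
          exact (min_eq_left (hl.2 ⟨k, ⟨hi, le_rfl⟩, rfl⟩)).symm
        · exact ⟨q, by rw [h, hq], fun h => absurd h hodd⟩
      · exact fresh (k + 1) h h'
      · exact extend _ hodd h rfl h'
      · exfalso
        obtain ⟨i, hi, hzi, -, hk⟩ := ih hodd
        have hgk : g (k + 1) = lam + g i := by
          rw [hgs, ← hzi, ← h', add_right_comm]
        obtain ⟨j, hj, hlt⟩ := hdtw i 0 zero_le
        rw [minPrioIcc_delayedSuffix, Nat.even_iff] at hj
        have hjg : (((projPlay π).trace.delayedSuffix i 0).st j).2 G.ta.gamma = g (i + j) := by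
          by_cases hj0 : j = 0 <;>
            simp [Trace.delayedSuffix, hj0, RawPlay.trace, projPlay, projState, hg, shift]
        have h0g : (((projPlay π).trace.delayedSuffix i 0).st 0).2 G.ta.gamma = g i := by
          simp [Trace.delayedSuffix, RawPlay.trace, projPlay, projState, hg, shift]
        rw [hjg, h0g] at hlt
        rcases Nat.lt_or_ge k (i + j) with hkj | hkj
        · have hle : (lam : ℝ≥0) ≤ g (i + j) - g i :=
            le_tsub_of_add_le_right (hgk ▸ hgm hkj)
          exact absurd (hlt.trans_le hle) (lt_irrefl _)
        · have := hk (i + j) (by omega) hkj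
          omega
  intro n
  obtain ⟨q, hq, -⟩ := hinv n
  change (π.s n).1.2 ≠ none
  rw [hq]
  exact Option.some_ne_none q

/-- For every well-initialized time-divergent play `π̄` of the
expanded game `G(p,λ)`: `π̄` satisfies `Safe(Bad)` iff its projection `Pr(π̄)`
satisfies `DTW(p,λ)` in `G`, where `Bad = L × {bad}`. -/
theorem statement7 {L C Act : Type} [Finite L] [Finite C] [Finite Act]
    (G : TG L C Act) (hwf : G.ta.WellFormed)
    (d : ℕ) (p : L → ℕ) (hp : ∀ ℓ, p ℓ < d)
    (lam : ℕ) (hlam : lam ≠ 0)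
    (π' : RawPlay (ExpLoc L) (ExpClock C) (ExpAct Act))
    (hπ' : (expTG G d p lam).IsPlay π')
    (hwi : WellInit p π')
    (hdiv : TimeDiv (some G.ta.gamma) π'.trace) :
    π'.trace ∈ SafeObj (BadLocs L) ↔ (projPlay π').trace ∈ DTW G.ta.gamma p lam :=
  ⟨projPlay_mem_DTW_of_safe hwf.1 hlam hπ' hwi hdiv,
    safe_of_projPlay_mem_DTW hwf.1 hπ' hwi⟩

end TWPaper
end
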